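/- arXiv:math/0002128 — 2 statements merged into one kernel-verified Lean document; each statement's English description precedes it below -/
import Mathlib

section
/- Let k be an algebraically closed field of characteristic 0 and let A, B be finite-dimensional associative unital k-algebras. Suppose F is a k-linear equivalence between the category of finite-dimensional left A-modules and the category of finite-dimensional left B-modules such that dim_k F(M) = dim_k M for every finite-dimensional left A-module M. Then F applied to the left regular module A is isomorphic, as a left B-module, to the left regular module B. -/
open CategoryTheory

noncomputable section

/-- The category of finitely generated (equivalently, finite-dimensional over `k`) modules
over a finite-dimensional `k`-algebra `A` is `k`-linear. -/
instance fgModuleCatLinearOverField (k : Type) [Field k] (A : Type) [Ring A] [Algebra k A] :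
    Linear k (FGModuleCat A) := by
  dsimp [FGModuleCat]; infer_instance

section FiniteDimensionalModules

variable {k B : Type} [Field k] [Ring B] [Algebra k B]

theorem finiteDimensional_linearMap_of_isScalarTower
    (M X : Type) [AddCommGroup M] [Module B M] [Module k M] [IsScalarTower k B M]
    [FiniteDimensional k M] [AddCommGroup X] [Module B X] [Module k X] [IsScalarTower k B X]
    [FiniteDimensional k X] : FiniteDimensional k (M →ₗ[B] X) :=
  Module.Finite.of_injective (LinearMap.restrictScalarsₗ k B M X k)
    (LinearMap.restrictScalars_injective k)

theorem finrank_linearMap_prod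
    (M N X : Type) [AddCommGroup M] [Module B M] [Module k M] [IsScalarTower k B M]
    [FiniteDimensional k M] [AddCommGroup N] [Module B N] [Module k N] [IsScalarTower k B N]
    [FiniteDimensional k N] [AddCommGroup X] [Module B X] [Module k X] [IsScalarTower k B X]
    [FiniteDimensional k X] :
    Module.finrank k (M × N →ₗ[B] X) =
      Module.finrank k (M →ₗ[B] X) + Module.finrank k (N →ₗ[B] X) := by
  have := finiteDimensional_linearMap_of_isScalarTower (k := k) (B := B) M X
  have := finiteDimensional_linearMap_of_isScalarTower (k := k) (B := B) N X
  rw [← (LinearMap.coprodEquiv k : ((M →ₗ[B] X) × (N →ₗ[B] X)) ≃ₗ[k] _).finrank_eq,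
    Module.finrank_prod]

/-- Finite-dimensional semisimple modules are determined up to isomorphism by the dimensions of
the spaces of homomorphisms out of them. -/
theorem IsSemisimpleModule.nonempty_linearEquiv_of_finrank_linearMap_eq
    (M N : Type) [AddCommGroup M] [Module B M] [Module k M] [IsScalarTower k B M]
    [FiniteDimensional k M] [AddCommGroup N] [Module B N] [Module k N] [IsScalarTower k B N]
    [FiniteDimensional k N] [IsSemisimpleModule B M] [IsSemisimpleModule B N]
    (h : ∀ (X : Type) [AddCommGroup X] [Module B X] [Module k X] [IsScalarTower k B X]
      [FiniteDimensional k X] [IsSemisimpleModule B X],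
      Module.finrank k (M →ₗ[B] X) = Module.finrank k (N →ₗ[B] X)) :
    Nonempty (M ≃ₗ[B] N) := by
  induction hn : Module.finrank k M using Nat.strong_induction_on generalizing M N with
  | _ n ih =>
  have := finiteDimensional_linearMap_of_isScalarTower (k := k) (B := B) N N
  rcases subsingleton_or_nontrivial M with hM | hM
  · have h0 : Module.finrank k (N →ₗ[B] N) = 0 := by
      rw [← h N]
      exact Module.finrank_zero_of_subsingleton
    have hs : Subsingleton (N →ₗ[B] N) := Module.finrank_zero_iff.mp h0
    have hN : Subsingleton N := subsingleton_of_forall_eq 0 fun x =>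
      LinearMap.congr_fun (Subsingleton.elim (LinearMap.id : N →ₗ[B] N) 0) x
    exact ⟨0⟩
  · obtain ⟨S, hS⟩ := IsSemisimpleModule.exists_simple_submodule B M
    obtain ⟨S', hSS'⟩ := exists_isCompl S
    have : FiniteDimensional k S :=
      inferInstanceAs (FiniteDimensional k (S.restrictScalars k))
    have : FiniteDimensional k S' :=
      inferInstanceAs (FiniteDimensional k (S'.restrictScalars k))
    have eM : (S × S') ≃ₗ[B] M := Submodule.prodEquivOfIsCompl S S' hSS'
    have := finiteDimensional_linearMap_of_isScalarTower (k := k) (B := B) S S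
    have hSpos : 0 < Module.finrank k (S →ₗ[B] S) := by
      have : Nontrivial S := IsSimpleModule.nontrivial B S
      have : Nontrivial (S →ₗ[B] S) := inferInstanceAs (Nontrivial (Module.End B S))
      exact Module.finrank_pos
    have hNpos : 0 < Module.finrank k (N →ₗ[B] S) := by
      rw [← h S, ← (LinearEquiv.congrLeft S k eM).finrank_eq, finrank_linearMap_prod]
      omega
    have := Module.nontrivial_of_finrank_pos hNpos
    obtain ⟨g, hg⟩ := exists_ne (0 : N →ₗ[B] S)
    have hgs := g.surjective_or_eq_zero.resolve_right hg
    obtain ⟨T, hT⟩ := exists_isCompl (LinearMap.ker g)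
    have : FiniteDimensional k (LinearMap.ker g) :=
      inferInstanceAs (FiniteDimensional k ((LinearMap.ker g).restrictScalars k))
    have eT : S ≃ₗ[B] T := (g.quotKerEquivOfSurjective hgs).symm.trans
      (Submodule.quotientEquivOfIsCompl _ _ hT)
    have eN : (S × LinearMap.ker g) ≃ₗ[B] N :=
      (eT.prodCongr (LinearEquiv.refl B _)).trans
        (Submodule.prodEquivOfIsCompl T _ hT.symm)
    have hlt : Module.finrank k S' < n := by
      have : Nontrivial S := IsSimpleModule.nontrivial B S
      have : 0 < Module.finrank k S := Module.finrank_pos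
      rw [← hn, ← (eM.restrictScalars k).finrank_eq, Module.finrank_prod]
      omega
    obtain ⟨e⟩ := ih _ hlt S' (LinearMap.ker g) (fun X => by
      intros
      have hX := h X
      rw [← (LinearEquiv.congrLeft X k eM).finrank_eq,
        ← (LinearEquiv.congrLeft X k eN).finrank_eq, finrank_linearMap_prod,
        finrank_linearMap_prod] at hX
      omega) rfl
    exact ⟨eM.symm.trans (((LinearEquiv.refl B S).prodCongr e).trans eN)⟩

/-- If `Hom(P, X)` has the same dimension as `X` for all finite-dimensional `X`, then maps out of
`P` lift along surjections of finite-dimensional modules. -/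
theorem exists_comp_eq_of_finrank_linearMap_eq
    (P : Type) [AddCommGroup P] [Module B P] [Module k P] [IsScalarTower k B P]
    [FiniteDimensional k P]
    (h : ∀ (X : Type) [AddCommGroup X] [Module B X] [Module k X] [IsScalarTower k B X]
      [FiniteDimensional k X], Module.finrank k (P →ₗ[B] X) = Module.finrank k X)
    {X Y : Type} [AddCommGroup X] [Module B X] [Module k X] [IsScalarTower k B X]
    [FiniteDimensional k X] [AddCommGroup Y] [Module B Y] [Module k Y] [IsScalarTower k B Y]
    [FiniteDimensional k Y] (g : X →ₗ[B] Y) (hg : Function.Surjective g) (f : P →ₗ[B] Y) :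
    ∃ f' : P →ₗ[B] X, g ∘ₗ f' = f := by
  have := finiteDimensional_linearMap_of_isScalarTower (k := k) (B := B) P X
  have := finiteDimensional_linearMap_of_isScalarTower (k := k) (B := B) P Y
  have : FiniteDimensional k (LinearMap.ker g) :=
    inferInstanceAs (FiniteDimensional k ((LinearMap.ker g).restrictScalars k))
  have := finiteDimensional_linearMap_of_isScalarTower (k := k) (B := B) P (LinearMap.ker g)
  let L : (P →ₗ[B] X) →ₗ[k] (P →ₗ[B] Y) :=
    { toFun := fun φ => g ∘ₗ φ
      map_add' := fun φ ψ => by ext; simp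
      map_smul' := fun c φ => by
        ext p
        exact (g.restrictScalars k).map_smul c (φ p) }
  let K : LinearMap.ker L →ₗ[k] (P →ₗ[B] LinearMap.ker g) :=
    { toFun := fun φ => φ.1.codRestrict _ fun p => LinearMap.congr_fun φ.2 p
      map_add' := fun φ ψ => rfl
      map_smul' := fun c φ => rfl }
  have hK : Function.Injective K := fun φ ψ hφψ => by
    ext p
    exact congrArg Subtype.val (LinearMap.congr_fun hφψ p)
  have h1 := LinearMap.finrank_le_finrank_of_injective hK
  have h2 := LinearMap.finrank_range_add_finrank_ker L
  have h3 := LinearMap.finrank_range_add_finrank_ker (g.restrictScalars k)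
  rw [LinearMap.range_eq_top.mpr (show Function.Surjective (g.restrictScalars k) from hg),
    finrank_top] at h3
  have h4 : Module.finrank k (LinearMap.ker (g.restrictScalars k)) =
    Module.finrank k (LinearMap.ker g) := rfl
  rw [h] at h1 h2
  have h5 : LinearMap.range L = ⊤ := by
    apply Submodule.eq_top_of_finrank_eq
    have := Submodule.finrank_le (LinearMap.range L)
    rw [h] at this ⊢
    omega
  exact LinearMap.range_eq_top.mp h5 f

/-- A map of finitely generated modules is surjective if it is surjective modulo the Jacobson
radical of the target. -/
theorem LinearMap.surjective_of_surjective_mkQ_jacobson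
    {P Q : Type} [AddCommGroup P] [Module B P] [AddCommGroup Q] [Module B Q] [Module.Finite B Q]
    (f : P →ₗ[B] Q) (hf : Function.Surjective ((Module.jacobson B Q).mkQ ∘ₗ f)) :
    Function.Surjective f := by
  rw [← LinearMap.range_eq_top]
  by_contra hne
  obtain ⟨m, hm, hle⟩ := (eq_top_or_exists_le_coatom (LinearMap.range f)).resolve_left hne
  have hj : Module.jacobson B Q ≤ m := sInf_le hm
  apply hm.1
  rw [eq_top_iff]
  intro x _
  obtain ⟨p, hp⟩ := hf ((Module.jacobson B Q).mkQ x)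
  have hx : f p - x ∈ Module.jacobson B Q := (Submodule.Quotient.eq _).mp hp
  simpa using m.sub_mem (hle ⟨p, rfl⟩) (hj hx)

/-- Homomorphisms to a semisimple module factor through the quotient by the Jacobson radical. -/
theorem finrank_linearMap_quotient_jacobson
    (P X : Type) [AddCommGroup P] [Module B P] [AddCommGroup X] [Module B X] [Module k X]
    [IsScalarTower k B X] [IsSemisimpleModule B X] :
    Module.finrank k ((P ⧸ Module.jacobson B P) →ₗ[B] X) = Module.finrank k (P →ₗ[B] X) := by
  let L : ((P ⧸ Module.jacobson B P) →ₗ[B] X) →ₗ[k] (P →ₗ[B] X) :=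
    { toFun := fun φ => φ ∘ₗ (Module.jacobson B P).mkQ
      map_add' := fun φ ψ => rfl
      map_smul' := fun c φ => rfl }
  refine (LinearEquiv.ofBijective L
    ⟨fun φ ψ h => Submodule.linearMap_qext _ h, fun f => ?_⟩).finrank_eq
  refine ⟨(Module.jacobson B P).liftQ f ?_, Submodule.liftQ_mkQ _ _ _⟩
  have := Module.le_comap_jacobson f
  rwa [IsSemisimpleModule.jacobson_eq_bot B X] at this

theorem finiteDimensional_quotient_of_isScalarTower (M : Type) [AddCommGroup M] [Module B M]
    [Module k M] [IsScalarTower k B M] [FiniteDimensional k M] (S : Submodule B M) :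
    FiniteDimensional k (M ⧸ S) :=
  Module.Finite.of_surjective (S.mkQ.restrictScalars k) S.mkQ_surjective

theorem isSemisimpleModule_quotient_jacobson (M : Type) [AddCommGroup M] [Module B M]
    [IsArtinian B M] : IsSemisimpleModule B (M ⧸ Module.jacobson B M) :=
  (IsArtinian.isSemisimpleModule_iff_jacobson B _).mpr (Module.jacobson_quotient_jacobson B M)

/-- A finite-dimensional module `P` with `dim Hom(P, X) = dim X` for all finite-dimensional `X`
is isomorphic to the regular module. -/
theorem nonempty_linearEquiv_self_of_finrank_linearMap_eq [FiniteDimensional k B]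
    (P : Type) [AddCommGroup P] [Module B P] [Module k P] [IsScalarTower k B P]
    [FiniteDimensional k P]
    (h : ∀ (X : Type) [AddCommGroup X] [Module B X] [Module k X] [IsScalarTower k B X]
      [FiniteDimensional k X], Module.finrank k (P →ₗ[B] X) = Module.finrank k X) :
    Nonempty (P ≃ₗ[B] B) := by
  have hB : ∀ (X : Type) [AddCommGroup X] [Module B X] [Module k X] [IsScalarTower k B X]
      [FiniteDimensional k X], Module.finrank k (B →ₗ[B] X) = Module.finrank k X :=
    fun X => by
      intros
      exact (LinearMap.ringLmapEquivSelf B k X).finrank_eq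
  have : Module.Finite B P := Module.Finite.of_restrictScalars_finite k B P
  have : IsArtinian B P := isArtinian_of_tower k inferInstance
  have : IsArtinian B B := isArtinian_of_tower k inferInstance
  have : IsSemisimpleModule B (P ⧸ Module.jacobson B P) :=
    isSemisimpleModule_quotient_jacobson P
  have : IsSemisimpleModule B (B ⧸ Module.jacobson B B) :=
    isSemisimpleModule_quotient_jacobson B
  have : FiniteDimensional k (P ⧸ Module.jacobson B P) :=
    finiteDimensional_quotient_of_isScalarTower P _
  have : FiniteDimensional k (B ⧸ Module.jacobson B B) :=
    finiteDimensional_quotient_of_isScalarTower B _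
  obtain ⟨e⟩ := IsSemisimpleModule.nonempty_linearEquiv_of_finrank_linearMap_eq (k := k) (B := B)
    (P ⧸ Module.jacobson B P) (B ⧸ Module.jacobson B B) (fun X => by
      intros
      rw [finrank_linearMap_quotient_jacobson, finrank_linearMap_quotient_jacobson, h, hB])
  obtain ⟨f, hf⟩ := exists_comp_eq_of_finrank_linearMap_eq P h (Module.jacobson B B).mkQ
    (Submodule.mkQ_surjective _) (e.toLinearMap ∘ₗ (Module.jacobson B P).mkQ)
  obtain ⟨g, hg⟩ := exists_comp_eq_of_finrank_linearMap_eq B hB (Module.jacobson B P).mkQ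
    (Submodule.mkQ_surjective _) (e.symm.toLinearMap ∘ₗ (Module.jacobson B B).mkQ)
  have hfs : Function.Surjective f := f.surjective_of_surjective_mkQ_jacobson (by
    rw [hf]
    exact e.surjective.comp (Submodule.mkQ_surjective _))
  have hgs : Function.Surjective g := g.surjective_of_surjective_mkQ_jacobson (by
    rw [hg]
    exact e.symm.surjective.comp (Submodule.mkQ_surjective _))
  have hfin : Module.finrank k P = Module.finrank k B := le_antisymm
    (LinearMap.finrank_le_finrank_of_surjective (f := g.restrictScalars k) hgs)
    (LinearMap.finrank_le_finrank_of_surjective (f := f.restrictScalars k) hfs)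
  have hfi : Function.Injective f :=
    (LinearMap.injective_iff_surjective_of_finrank_eq_finrank (f := f.restrictScalars k) hfin).mpr
      hfs
  exact ⟨LinearEquiv.ofBijective f ⟨hfi, hfs⟩⟩

end FiniteDimensionalModules

/-- Let `k` be an algebraically closed field of characteristic `0` and `A`, `B`
finite-dimensional associative unital `k`-algebras.  If `F` is a `k`-linear equivalence
between the categories of finite-dimensional left `A`-modules and left `B`-modules with
`dim_k F(M) = dim_k M` for all `M`, then `F` sends the left regular module `A` to a module
isomorphic to the left regular module `B`. -/
theorem equivalence_image_of_regular_module
    (k : Type) [Field k] [IsAlgClosed k] [CharZero k]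
    (A B : Type) [Ring A] [Ring B] [Algebra k A] [Algebra k B]
    [FiniteDimensional k A] [FiniteDimensional k B]
    (F : FGModuleCat A ⥤ FGModuleCat B) [F.IsEquivalence] [F.Additive] [F.Linear k]
    (hdim : ∀ M : FGModuleCat A,
      Module.finrank k (RestrictScalars k B (F.obj M)) =
        Module.finrank k (RestrictScalars k A M)) :
    Nonempty (F.obj (FGModuleCat.of A A) ≅ FGModuleCat.of B B) := by
  let _ (C : Type) [Ring C] [Algebra k C] (M : FGModuleCat C) : Module k M :=
    Module.restrictScalars k C M
  have (C : Type) [Ring C] [Algebra k C] (M : FGModuleCat C) : IsScalarTower k C M :=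
    IsScalarTower.restrictScalars k C M
  have (C : Type) [Ring C] [Algebra k C] [FiniteDimensional k C] (M : FGModuleCat C) :
      FiniteDimensional k M := Module.Finite.trans C M
  obtain ⟨e⟩ := nonempty_linearEquiv_self_of_finrank_linearMap_eq (k := k) (B := B)
    (F.obj (FGModuleCat.of A A)) (fun X => by
      intros
      have : Module.Finite B X := Module.Finite.of_restrictScalars_finite k B X
      obtain ⟨N, ⟨i⟩⟩ := Functor.EssSurj.mem_essImage F (FGModuleCat.of B X)
      let ε : F.obj N ≃ₗ[B] X := FGModuleCat.isoToLinearEquiv i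
      let L : N →ₗ[k] (F.obj (FGModuleCat.of A A) →ₗ[B] X) :=
        { toFun := fun n => ε.toLinearMap ∘ₗ
            (F.map (FGModuleCat.ofHom (LinearMap.toSpanSingleton A N n) :
              FGModuleCat.of A A ⟶ N)).hom.hom
          map_add' := fun m n => by
            have h1 : (FGModuleCat.ofHom (LinearMap.toSpanSingleton A N (m + n)) :
                FGModuleCat.of A A ⟶ N) =
                FGModuleCat.ofHom (LinearMap.toSpanSingleton A N m) +
                  FGModuleCat.ofHom (LinearMap.toSpanSingleton A N n) := by
              ext : 1
              exact LinearMap.toSpanSingleton_add m n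
            rw [h1, F.map_add]
            exact LinearMap.comp_add _ _ _
          map_smul' := fun c n => by
            have h1 : (FGModuleCat.ofHom (LinearMap.toSpanSingleton A N (c • n)) :
                FGModuleCat.of A A ⟶ N) =
                c • (FGModuleCat.ofHom (LinearMap.toSpanSingleton A N n) :
                  FGModuleCat.of A A ⟶ N) := by
              ext : 1
              refine LinearMap.ext fun a => ?_
              exact smul_comm a c n
            rw [h1, F.map_smul]
            refine LinearMap.ext fun p => ?_
            exact (ε.toLinearMap.restrictScalars k).map_smul c _ }
      have hL : Function.Bijective L := by
        refine ⟨fun m n hmn => ?_, fun f => ?_⟩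
        · have h1 : (F.map (FGModuleCat.ofHom (LinearMap.toSpanSingleton A N m) :
              FGModuleCat.of A A ⟶ N)) =
              F.map (FGModuleCat.ofHom (LinearMap.toSpanSingleton A N n) :
                FGModuleCat.of A A ⟶ N) := by
            ext p
            exact ε.injective (LinearMap.congr_fun hmn p)
          have h2 := congrArg (fun φ => φ.hom.hom (1 : A)) (F.map_injective h1)
          exact ((one_smul A m).symm.trans h2).trans (one_smul A n)
        · obtain ⟨φ, hφ⟩ := F.map_surjective
            (FGModuleCat.ofHom (ε.symm.toLinearMap ∘ₗ f) : F.obj (FGModuleCat.of A A) ⟶ F.obj N)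
          refine ⟨φ.hom.hom (1 : A), ?_⟩
          have h1 : (FGModuleCat.ofHom (LinearMap.toSpanSingleton A N (φ.hom.hom (1 : A))) :
              FGModuleCat.of A A ⟶ N) = φ := by
            ext : 1
            exact LinearMap.ext_ring (one_smul A _)
          refine LinearMap.ext fun p => ?_
          change ε ((F.map (FGModuleCat.ofHom (LinearMap.toSpanSingleton A N
            (φ.hom.hom (1 : A))) : FGModuleCat.of A A ⟶ N)).hom.hom p) = f p
          rw [h1, hφ]
          exact ε.apply_symm_apply (f p)
      rw [← (LinearEquiv.ofBijective L hL).finrank_eq, ← (ε.restrictScalars k).finrank_eq]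
      exact (hdim N).symm)
  exact ⟨e.toFGModuleCatIso⟩

end
end

section
/- Let g be a finite-dimensional reductive Lie algebra over a field k of characteristic 0. Suppose there exists a nondegenerate alternating bilinear form ω : g × g → k satisfying the Lie algebra 2-cocycle identity ω([x,y],z) + ω([y,z],x) + ω([z,x],y) = 0 for all x,y,z ∈ g. Then g is abelian. -/
open LieAlgebra

namespace LieAlgebra

lemma killingForm_apply_of_mem_center {k L : Type*} [CommRing k] [LieRing L] [LieAlgebra k L]
    {x : L} (hx : x ∈ center k L) (y : L) :
    killingForm k L x y = 0 := by
  have : ad k L x = 0 := by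
    ext z
    have := (LieModule.mem_maxTrivSubmodule k L L x).mp hx z
    rw [ad_apply, ← lie_skew, this, neg_zero, LinearMap.zero_apply]
  simp [killingForm_apply_apply, this]

section Killing

variable {k L : Type*} [Field k] [LieRing L] [LieAlgebra k L] [Module.Finite k L]

/-- A scalar-valued 2-cocycle on a Killing Lie algebra is a coboundary. -/
lemma IsKilling.exists_killingForm_lie_eq_of_cocycle [IsKilling k L]
    (ω : L →ₗ[k] L →ₗ[k] k) (halt : ∀ x, ω x x = 0)
    (hcocycle : ∀ x y z, ω ⁅x, y⁆ z + ω ⁅y, z⁆ x + ω ⁅z, x⁆ y = 0) :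
    ∃ u : L, ∀ x y, ω x y = killingForm k L u ⁅x, y⁆ := by
  have hskew : ∀ x y, ω x y = -ω y x := fun x y ↦ by
    have := halt (x + y)
    simp only [map_add, LinearMap.add_apply, halt, zero_add, add_zero] at this
    exact eq_neg_of_add_eq_zero_right this
  have hinv : ∀ x y z, killingForm k L ⁅x, y⁆ z = killingForm k L x ⁅y, z⁆ :=
    LieModule.traceForm_apply_lie_apply k L L
  have hnd := IsKilling.killingForm_nondegenerate k L
  let δ : L →ₗ[k] L :=
    (LinearMap.BilinForm.toDual (killingForm k L) hnd).symm.toLinearMap ∘ₗ ω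
  have hδ : ∀ x y, killingForm k L (δ x) y = ω x y := fun x y ↦
    LinearMap.BilinForm.apply_toDual_symm_apply (hB := hnd) (ω x) y
  let D : LieDerivation k L L :=
    { toLinearMap := δ
      leibniz' := fun x y ↦ by
        refine sub_eq_zero.mp (hnd.1 _ fun z ↦ ?_)
        simp only [map_sub, LinearMap.sub_apply]
        rw [← lie_skew x (δ y), ← lie_skew y (δ x)]
        simp only [map_neg, LinearMap.neg_apply, hinv, hδ]
        have h := hcocycle x y z
        rw [hskew ⁅y, z⁆, hskew ⁅z, x⁆, ← lie_skew z x, map_neg] at h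
        linear_combination h }
  obtain ⟨u, hu⟩ := LieDerivation.IsKilling.exists_eq_ad D
  refine ⟨u, fun x y ↦ ?_⟩
  have hux : ⁅u, x⁆ = δ x := by
    rw [← LieDerivation.ad_apply_apply k, hu]
    rfl
  rw [← hδ, ← hinv, hux]

end Killing

section Reductive

variable {k L : Type*} [Field k] [CharZero k] [LieRing L] [LieAlgebra k L] [Module.Finite k L]

lemma killingCompl_derivedSeries_one_le_radical :
    (derivedSeries k L 1).killingCompl ≤ radical k L := by
  rw [← LieIdeal.solvable_iff_le_radical]
  refine LieIdeal.isSolvable_of_killingForm_apply_lie_eq_zero _ fun x hx y hy ↦ ?_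
  rw [LieIdeal.mem_killingCompl] at hx
  rw [LieModule.traceForm_comm]
  exact hx y (LieSubmodule.mono_lie le_top le_top hy)

lemma HasCentralRadical.killingCompl_derivedSeries_one [HasCentralRadical k L] :
    (derivedSeries k L 1).killingCompl = center k L := by
  refine le_antisymm (killingCompl_derivedSeries_one_le_radical.trans_eq radical_eq_center)
    fun x hx ↦ ?_
  rw [LieIdeal.mem_killingCompl]
  intro y _
  rw [LieModule.traceForm_comm]
  exact killingForm_apply_of_mem_center hx y

lemma HasCentralRadical.derivedSeries_one_sup_center [HasCentralRadical k L] :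
    (derivedSeries k L 1).toSubmodule ⊔ (center k L).toSubmodule = ⊤ := by
  have hker : LinearMap.ker (killingForm k L) = (center k L).toSubmodule := by
    refine le_antisymm (fun x hx ↦ ?_) fun x hx ↦ ?_
    · rw [← killingCompl_derivedSeries_one]
      refine (LieIdeal.mem_killingCompl ..).mpr fun y _ ↦ ?_
      rw [LieModule.traceForm_comm]
      exact LinearMap.congr_fun hx y
    · exact LinearMap.ext fun y ↦ killingForm_apply_of_mem_center hx y
  have h := LinearMap.BilinForm.finrank_add_finrank_orthogonal
    (LieModule.traceForm_isSymm k L L).isRefl (derivedSeries k L 1).toSubmodule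
  rw [← LieIdeal.toSubmodule_killingCompl, killingCompl_derivedSeries_one,
    LinearMap.BilinForm.orthogonal_top_eq_ker (LieModule.traceForm_isSymm k L L).isRefl,
    hker, ← Submodule.finrank_sup_add_finrank_inf_eq] at h
  exact Submodule.eq_top_of_finrank_eq (Nat.add_right_cancel h)

/-- The derived ideal of a reductive Lie algebra is Killing if it meets the center trivially. -/
lemma HasCentralRadical.isKilling_derivedSeries_one [HasCentralRadical k L]
    (h : ∀ x ∈ derivedSeries k L 1, x ∈ center k L → x = 0) :
    IsKilling k (derivedSeries k L 1) where
  killingCompl_top_eq_bot := by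
    rw [eq_bot_iff]
    intro x hx
    rw [LieIdeal.mem_killingCompl] at hx
    refine Subtype.ext (h x x.2 ?_)
    rw [← killingCompl_derivedSeries_one, LieIdeal.mem_killingCompl]
    intro y hy
    have : killingForm k (derivedSeries k L 1) ⟨y, hy⟩ x = 0 := hx ⟨y, hy⟩ trivial
    rwa [LieIdeal.killingForm_eq] at this

end Reductive

end LieAlgebra

/-- A finite-dimensional reductive Lie algebra (over a field of
characteristic zero) carrying a nondegenerate alternating bilinear form satisfying the
Lie algebra 2-cocycle identity is abelian.  Reductivity is expressed as: the solvable
radical equals the center. -/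
theorem isLieAbelian_of_reductive_of_symplectic_cocycle
    {k : Type} [Field k] [CharZero k]
    {g : Type} [LieRing g] [LieAlgebra k g] [Module.Finite k g]
    (hred : LieAlgebra.radical k g = LieAlgebra.center k g)
    (ω : g →ₗ[k] g →ₗ[k] k)
    (halt : ∀ x : g, ω x x = 0)
    (hnondeg : ∀ x : g, (∀ y : g, ω x y = 0) → x = 0)
    (hcocycle : ∀ x y z : g, ω ⁅x, y⁆ z + ω ⁅y, z⁆ x + ω ⁅z, x⁆ y = 0) :
    IsLieAbelian g := by
  have : HasCentralRadical k g := ⟨hred⟩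
  set D := derivedSeries k g 1 with hD
  have hsup : ∀ x, (∀ y ∈ D, ω x y = 0) → (∀ y ∈ center k g, ω x y = 0) → x = 0 :=
    fun x h₁ h₂ ↦ hnondeg x fun y ↦ by
      have hy : y ∈ D.toSubmodule ⊔ (center k g).toSubmodule := by
        rw [HasCentralRadical.derivedSeries_one_sup_center]; trivial
      obtain ⟨a, ha, b, hb, rfl⟩ := Submodule.mem_sup.mp hy
      rw [map_add, h₁ a ha, h₂ b hb, add_zero]
  have hskew : ∀ x y, ω x y = 0 → ω y x = 0 := LinearMap.IsAlt.isRefl halt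
  have hDZ : ∀ x ∈ D, ∀ z ∈ center k g, ω x z = 0 := fun x hx z hz ↦ by
    have hz' (y : g) : ⁅y, z⁆ = 0 := (LieModule.mem_maxTrivSubmodule k g g z).mp hz y
    have hx' : x ∈ (LieIdeal.toLieSubalgebra k g D).toSubmodule := hx
    rw [hD, coe_derivedSeries_one_eq] at hx'
    refine Submodule.span_le (p := LinearMap.ker (ω.flip z)).mpr ?_ hx'
    rintro _ ⟨a, b, rfl⟩
    have h := hcocycle a b z
    rw [hz', ← lie_skew z a, hz'] at h
    simpa using h
  have hinf : ∀ x ∈ D, x ∈ center k g → x = 0 := fun x hx hxZ ↦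
    hsup x (fun y hy ↦ hskew y x (hDZ y hy x hxZ)) (hDZ x hx)
  have := HasCentralRadical.isKilling_derivedSeries_one hinf
  obtain ⟨u, hu⟩ := IsKilling.exists_killingForm_lie_eq_of_cocycle (L := D)
    (ω.domRestrict₁₂ D.toSubmodule D.toSubmodule)
    (fun x ↦ halt x) (fun x y z ↦ hcocycle x y z)
  have hu0 : u = 0 := Subtype.ext <| hsup u (fun y hy ↦ by
    have := hu u ⟨y, hy⟩
    rw [← LieModule.traceForm_apply_lie_apply, lie_self, map_zero] at this
    exact this) (hDZ u u.2)
  have hbot : ∀ x ∈ D, x = 0 := fun x hx ↦ hsup x (fun y hy ↦ by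
    have := hu ⟨x, hx⟩ ⟨y, hy⟩
    rwa [hu0, map_zero] at this) (hDZ x hx)
  refine ⟨fun x y ↦ hbot _ ?_⟩
  exact LieSubmodule.lie_mem_lie (LieSubmodule.mem_top x) (LieSubmodule.mem_top y)
end
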